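/- Let F be a field and s a positive integer. Let I, I′ ⊆ F be finite sets with |I| ≤ s and |I′| ≤ s, and let c : I → F and c′ : I′ → F be everywhere nonzero. If Σ_{j ∈ I} c_j · j^{l} = Σ_{j ∈ I′} c′_j · j^{l} for every l = 0, 1, …, 2s−1, then I = I′ and c_j = c′_j for all j ∈ I. -/

import Mathlib

/-- A weight on a finite subset `S` of a domain is zero on `S` if its first `|S|` power moments
vanish. -/
theorem Finset.eq_zero_of_forall_sum_mul_pow_eq_zero {R : Type*} [CommRing R] [IsDomain R]
    (S : Finset R) (d : R → R) (h : ∀ l < S.card, ∑ j ∈ S, d j * j ^ l = 0) :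
    ∀ j ∈ S, d j = 0 := by
  let e := S.equivFin
  have hinj : Function.Injective fun i => (e.symm i : R) :=
    Subtype.val_injective.comp e.symm.injective
  have hzero : (fun i => d (e.symm i)) = 0 := by
    refine Matrix.eq_zero_of_forall_pow_sum_mul_pow_eq_zero hinj fun l => ?_
    rw [e.symm.sum_comp fun j : S => d j * (j : R) ^ (l : ℕ),
      Finset.sum_coe_sort S fun j => d j * j ^ (l : ℕ)]
    exact h l l.isLt
  intro j hj
  simpa using congrFun hzero (e ⟨j, hj⟩)

/-- Uniqueness from `2s` measurements: if `I, I'` are finite subsets of a field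
`F` of cardinality at most `s`, `c, c'` are nowhere vanishing on `I, I'`
respectively, and `∑_{j ∈ I} c j * j ^ l = ∑_{j ∈ I'} c' j * j ^ l` for every
`l = 0, …, 2s - 1`, then `I = I'` and `c = c'` on `I`. -/
theorem sparse_exponential_sum_unique
    (F : Type*) [Field F] (s : ℕ) (hs : 0 < s)
    (I I' : Finset F) (hI : I.card ≤ s) (hI' : I'.card ≤ s)
    (c c' : F → F) (hc : ∀ j ∈ I, c j ≠ 0) (hc' : ∀ j ∈ I', c' j ≠ 0)
    (h : ∀ l : ℕ, l < 2 * s →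
      ∑ j ∈ I, c j * j ^ l = ∑ j ∈ I', c' j * j ^ l) :
    I = I' ∧ ∀ j ∈ I, c j = c' j := by
  classical
  have hd : ∀ j ∈ I ∪ I', (if j ∈ I then c j else 0) - (if j ∈ I' then c' j else 0) = 0 := by
    refine Finset.eq_zero_of_forall_sum_mul_pow_eq_zero (I ∪ I')
      (fun j => (if j ∈ I then c j else 0) - (if j ∈ I' then c' j else 0)) fun l hl => ?_
    have hcard := Finset.card_union_le I I'
    have hI_sum := Finset.sum_ite_mem (I ∪ I') I fun j => c j * j ^ l
    have hI'_sum := Finset.sum_ite_mem (I ∪ I') I' fun j => c' j * j ^ l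
    rw [Finset.inter_eq_right.mpr Finset.subset_union_left] at hI_sum
    rw [Finset.inter_eq_right.mpr Finset.subset_union_right] at hI'_sum
    simp only [sub_mul, ite_mul, zero_mul, Finset.sum_sub_distrib]
    rw [hI_sum, hI'_sum, h l (by omega), sub_self]
  have hII' : I = I' := by
    ext j
    constructor
    · intro hj
      by_contra hj'
      exact hc j hj (by simpa [hj, hj'] using hd j (Finset.mem_union_left _ hj))
    · intro hj'
      by_contra hj
      exact hc' j hj' (by simpa [hj, hj'] using hd j (Finset.mem_union_right _ hj'))
  subst hII'
  exact ⟨rfl, fun j hj => by simpa [hj, sub_eq_zero] using hd j (Finset.mem_union_left _ hj)⟩
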